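/- arXiv:2212.09893 — 2 statements merged into one kernel-verified Lean document; each statement's English description precedes it below -/
import Mathlib

section
/- There exists a decomposable continuum X, not homeomorphic to the arc [0,1], such that X² \ Δ is not continuumwise connected in X². -/
open Set

/-- A subset `R` of a space `Y` is continuumwise connected if any two of its points lie in
a subcontinuum of `Y` (a nonempty compact connected subset) contained in `R`. -/
def ContinuumwiseConnected {Y : Type*} [TopologicalSpace Y] (R : Set Y) : Prop :=
  ∀ p ∈ R, ∀ q ∈ R, ∃ M : Set Y, IsCompact M ∧ IsConnected M ∧ p ∈ M ∧ q ∈ M ∧ M ⊆ R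

namespace SineCurve

open Filter Topology

noncomputable def g (x : ℝ) : ℝ × ℝ := (x, Real.sin x⁻¹)

noncomputable def T (c : ℝ) : Set (ℝ × ℝ) := closure (g '' Ioc 0 c)

lemma g_cont {s : Set ℝ} (hs : ∀ x ∈ s, 0 < x) : ContinuousOn g s := by
  unfold g
  refine continuousOn_id.prodMk (Real.continuous_sin.comp_continuousOn ?_)
  exact continuousOn_id.inv₀ (fun x hx => (hs x hx).ne')

lemma cont_aux : Continuous (fun x : ℝ => x * Real.sin x⁻¹) := by
  rw [continuous_iff_continuousAt]
  intro x
  by_cases hx : x = 0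
  · subst hx
    unfold ContinuousAt
    simp only [zero_mul]
    refine squeeze_zero_norm (a := fun x : ℝ => |x|) ?_ ?_
    · intro x
      rw [Real.norm_eq_abs, abs_mul]
      exact mul_le_of_le_one_right (abs_nonneg _) (Real.abs_sin_le_one _)
    · simpa using (continuous_abs (G := ℝ)).tendsto 0
  · exact continuousAt_id.mul (Real.continuous_sin.continuousAt.comp (continuousAt_inv₀ hx))

lemma T_sub {c : ℝ} {p : ℝ × ℝ} (hp : p ∈ T c) :
    (0 ≤ p.1 ∧ p.1 ≤ c) ∧ (-1 ≤ p.2 ∧ p.2 ≤ 1) ∧ p.1 * p.2 = p.1 * Real.sin p.1⁻¹ := by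
  have hcl : IsClosed {p : ℝ × ℝ | (0 ≤ p.1 ∧ p.1 ≤ c) ∧ (-1 ≤ p.2 ∧ p.2 ≤ 1) ∧
      p.1 * p.2 = p.1 * Real.sin p.1⁻¹} := by
    have h1 : IsClosed {p : ℝ × ℝ | 0 ≤ p.1} := isClosed_le continuous_const continuous_fst
    have h2 : IsClosed {p : ℝ × ℝ | p.1 ≤ c} := isClosed_le continuous_fst continuous_const
    have h3 : IsClosed {p : ℝ × ℝ | -1 ≤ p.2} := isClosed_le continuous_const continuous_snd
    have h4 : IsClosed {p : ℝ × ℝ | p.2 ≤ 1} := isClosed_le continuous_snd continuous_const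
    have h5 : IsClosed {p : ℝ × ℝ | p.1 * p.2 = p.1 * Real.sin p.1⁻¹} :=
      isClosed_eq (continuous_fst.mul continuous_snd) (cont_aux.comp continuous_fst)
    exact (h1.inter h2).inter ((h3.inter h4).inter h5)
  refine closure_minimal ?_ hcl hp
  rintro _ ⟨x, hx, rfl⟩
  exact ⟨⟨hx.1.le, hx.2⟩, ⟨Real.neg_one_le_sin _, Real.sin_le_one _⟩, rfl⟩

lemma T_compact (c : ℝ) : IsCompact (T c) := by
  have h : IsCompact (Icc 0 c ×ˢ Icc (-1 : ℝ) 1) := isCompact_Icc.prod isCompact_Icc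
  exact h.of_isClosed_subset isClosed_closure
    (fun p hp => ⟨(T_sub hp).1, (T_sub hp).2.1⟩)

lemma T_conn {c : ℝ} (hc : 0 < c) : IsConnected (T c) :=
  ((isConnected_Ioc hc).image g (g_cont (fun _ hx => hx.1))).closure

lemma seq_tendsto (θ : ℝ) :
    Tendsto (fun n : ℕ => (θ + n * (2 * Real.pi))⁻¹) atTop (𝓝 0) := by
  apply tendsto_inv_atTop_zero.comp
  apply tendsto_atTop_add_const_left
  exact tendsto_natCast_atTop_atTop.atTop_mul_const (by positivity)

lemma seq_pos (θ : ℝ) :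
    ∀ᶠ n : ℕ in atTop, 0 < (θ + n * (2 * Real.pi))⁻¹ := by
  have : Tendsto (fun n : ℕ => θ + n * (2 * Real.pi)) atTop atTop := by
    apply tendsto_atTop_add_const_left
    exact tendsto_natCast_atTop_atTop.atTop_mul_const (by positivity)
  filter_upwards [this.eventually_gt_atTop 0] with n hn
  exact inv_pos.2 hn

lemma bar_sub {c : ℝ} (hc : 0 < c) {y : ℝ} (hy : y ∈ Icc (-1 : ℝ) 1) : ((0 : ℝ), y) ∈ T c := by
  have ht : Tendsto (fun n : ℕ => (((Real.arcsin y + n * (2 * Real.pi))⁻¹, y) : ℝ × ℝ)) atTop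
      (𝓝 (0, y)) := (seq_tendsto _).prodMk_nhds tendsto_const_nhds
  refine mem_closure_of_tendsto ht ?_
  filter_upwards [seq_pos (Real.arcsin y),
    (seq_tendsto (Real.arcsin y)).eventually (eventually_le_nhds hc)] with n h1 h2
  refine ⟨_, ⟨h1, h2⟩, ?_⟩
  simp [g, Real.sin_add_nat_mul_two_pi, Real.sin_arcsin hy.1 hy.2]

lemma exists_a {ε : ℝ} (hε : 0 < ε) : ∃ a : ℝ, 0 < a ∧ a < ε ∧ Real.sin a⁻¹ = 1 := by
  obtain ⟨n, h1, h2⟩ := ((seq_pos (Real.pi / 2)).and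
    ((seq_tendsto (Real.pi / 2)).eventually (eventually_lt_nhds hε))).exists
  exact ⟨_, h1, h2, by simp [Real.sin_add_nat_mul_two_pi]⟩

lemma T_graph {c : ℝ} {p : ℝ × ℝ} (hp : p ∈ T c) (h : 0 < p.1) : p.2 = Real.sin p.1⁻¹ :=
  mul_left_cancel₀ h.ne' (T_sub hp).2.2

lemma exists_map {ε : ℝ} (hε : 0 < ε) :
    ∃ f : T 1 → ℝ, Continuous f ∧ ∀ p q, f p = f q → dist p q < ε := by
  obtain ⟨a, ha, hae, hs⟩ := exists_a hε
  refine ⟨fun p => if p.1.1 ≤ a then p.1.2 else 1 + p.1.1 - a, ?_, ?_⟩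
  · refine Continuous.if_le (by fun_prop) (by fun_prop) (by fun_prop) (by fun_prop) ?_
    intro p hp
    rw [T_graph p.2 (by rw [hp]; exact ha), hp, hs]; ring
  · rintro ⟨⟨x, y⟩, hp⟩ ⟨⟨x', y'⟩, hq⟩ h
    have hp' := T_sub hp
    have hq' := T_sub hq
    have gp := T_graph hp
    have gq := T_graph hq
    simp only at h hp' hq' gp gq
    rw [Subtype.dist_eq, Prod.dist_eq, max_lt_iff, Real.dist_eq, Real.dist_eq, abs_lt, abs_lt]
    simp only
    split_ifs at h with h1 h2 h2
    · refine ⟨⟨?_, ?_⟩, ?_, ?_⟩ <;> linarith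
    · linarith
    · linarith
    · have : x = x' := by linarith
      subst this
      have : y = y' := by rw [gp (by linarith), gq (by linarith)]
      subst this
      simp [hε]

lemma lift_conn {s : Set (ℝ × ℝ)} (hs : s ⊆ T 1) (h : IsConnected s) :
    IsConnected ((↑) ⁻¹' s : Set (T 1)) := by
  have him : ((↑) : T 1 → ℝ × ℝ) '' ((↑) ⁻¹' s) = s := by
    rw [Subtype.image_preimage_coe, inter_eq_right]; exact hs
  refine ⟨?_, ?_⟩
  · obtain ⟨x, hx⟩ := h.1
    exact ⟨⟨x, hs hx⟩, hx⟩
  · rw [← Topology.IsInducing.subtypeVal.isPreconnected_image, him]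
    exact h.2

lemma lift_compact {s : Set (ℝ × ℝ)} (h : IsCompact s) :
    IsCompact ((↑) ⁻¹' s : Set (T 1)) :=
  (isClosed_closure.isClosedEmbedding_subtypeVal).isCompact_preimage h

lemma not_arc : ¬ Nonempty (T 1 ≃ₜ ↥(Set.Icc (0:ℝ) 1)) := by
  rintro ⟨e⟩
  have hbar : IsConnected (((fun y : ℝ => ((0 : ℝ), y)) '' Icc (-1 : ℝ) 1)) :=
    (isConnected_Icc (by norm_num)).image _ (by fun_prop)
  have hsub : ((fun y : ℝ => ((0 : ℝ), y)) '' Icc (-1 : ℝ) 1) ⊆ T 1 := by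
    rintro _ ⟨y, hy, rfl⟩; exact bar_sub one_pos hy
  have hB := lift_conn hsub hbar
  have hE := (hB.image e e.continuous.continuousOn).isPreconnected.ordConnected
  have key : ∀ p q : T 1, p.1.1 = 0 → q.1.1 = 0 → e p < e q → False := by
    intro p q hp hq hlt
    have hmem : ∀ p : T 1, p.1.1 = 0 →
        p ∈ ((↑) ⁻¹' ((fun y : ℝ => ((0 : ℝ), y)) '' Icc (-1 : ℝ) 1) : Set (T 1)) := by
      intro p hp
      exact ⟨p.1.2, (T_sub p.2).2.1, by ext <;> simp [hp]⟩
    have hI : Icc (e p) (e q) ⊆ _ := hE.out (mem_image_of_mem e (hmem p hp))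
      (mem_image_of_mem e (hmem q hq))
    obtain ⟨m, hm⟩ := exists_between hlt
    have hopen : IsOpen (e ⁻¹' Ioo (e p) (e q)) := isOpen_Ioo.preimage e.continuous
    obtain ⟨U, hU, hUe⟩ := isOpen_induced_iff.1 hopen
    have hmU : (e.symm m).1 ∈ U := by
      have : e.symm m ∈ e ⁻¹' Ioo (e p) (e q) := by simpa using hm
      rw [← hUe] at this
      exact this
    obtain ⟨z, hzU, x, hx, rfl⟩ := mem_closure_iff.1 (e.symm m).2 U hU hmU
    have hz : (⟨g x, subset_closure ⟨x, hx, rfl⟩⟩ : T 1) ∈ e ⁻¹' Ioo (e p) (e q) := by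
      rw [← hUe]; exact hzU
    obtain ⟨w, ⟨y, -, hw⟩, hwe⟩ := hI (Ioo_subset_Icc_self hz)
    have := e.injective hwe
    subst this
    have h0 := congrArg Prod.fst hw
    simp only [g] at h0
    exact hx.1.ne h0
  have h0 : ((0 : ℝ), (0 : ℝ)) ∈ T 1 := bar_sub one_pos (by constructor <;> norm_num)
  have h1 : ((0 : ℝ), (1 : ℝ)) ∈ T 1 := bar_sub one_pos (by constructor <;> norm_num)
  rcases lt_trichotomy (e ⟨_, h0⟩) (e ⟨_, h1⟩) with h | h | h
  · exact key _ _ rfl rfl h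
  · have := e.injective h
    simp at this
  · exact key _ _ rfl rfl h

lemma not_cw : ¬ ContinuumwiseConnected {w : T 1 × T 1 | w.1 ≠ w.2} := by
  intro H
  have h0 : ((0 : ℝ), (0 : ℝ)) ∈ T 1 := bar_sub one_pos (by constructor <;> norm_num)
  have h1 : ((0 : ℝ), (1 : ℝ)) ∈ T 1 := bar_sub one_pos (by constructor <;> norm_num)
  set p : T 1 := ⟨_, h0⟩
  set q : T 1 := ⟨_, h1⟩
  have hne : p ≠ q := by simp [p, q]
  obtain ⟨M, hMc, hM, hpq, hqp, hsub⟩ := H (p, q) hne (q, p) hne.symm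
  obtain ⟨w, hw, hmin⟩ := hMc.exists_isMinOn hM.1
    (f := fun w : T 1 × T 1 => dist w.1 w.2) (by fun_prop)
  obtain ⟨f, hf, hfe⟩ := exists_map (dist_pos.2 (hsub hw))
  have hc : ContinuousOn (fun w : T 1 × T 1 => f w.1 - f w.2) M := by fun_prop
  have hex : ∃ v ∈ M, f v.1 - f v.2 = 0 := by
    have himg := (hM.2.image _ hc).ordConnected
    have a1 := mem_image_of_mem (fun w : T 1 × T 1 => f w.1 - f w.2) hpq
    have a2 := mem_image_of_mem (fun w : T 1 × T 1 => f w.1 - f w.2) hqp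
    rcases le_total (f p) (f q) with h | h
    · exact himg.out a1 a2 ⟨by simpa using h, by simpa using h⟩
    · exact himg.out a2 a1 ⟨by simpa using h, by simpa using h⟩
  obtain ⟨v, hv, hv0⟩ := hex
  exact absurd (hmin hv) (not_le.2 (hfe _ _ (sub_eq_zero.1 hv0)))

lemma decomp : ∃ A B : Set (T 1), IsCompact A ∧ IsConnected A ∧ IsCompact B ∧ IsConnected B ∧
        A ≠ univ ∧ B ≠ univ ∧ A ∪ B = univ := by
  have hcB : ContinuousOn g (Icc (1/2) 1) := g_cont (fun x hx => by linarith [hx.1])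
  have hBc : IsCompact (g '' Icc (1/2) 1) := isCompact_Icc.image_of_continuousOn hcB
  have hBs : g '' Icc (1/2) 1 ⊆ T 1 := by
    rintro _ ⟨x, hx, rfl⟩
    exact subset_closure ⟨x, ⟨by linarith [hx.1], hx.2⟩, rfl⟩
  have hAs : T (1/2) ⊆ T 1 :=
    closure_mono (image_mono (Ioc_subset_Ioc_right (by norm_num)))
  refine ⟨(↑) ⁻¹' T (1/2), (↑) ⁻¹' (g '' Icc (1/2) 1), lift_compact (T_compact _),
    lift_conn hAs (T_conn (by norm_num)), lift_compact hBc,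
    lift_conn hBs ((isConnected_Icc (by norm_num)).image _ hcB), ?_, ?_, ?_⟩
  · intro h
    have : (⟨g 1, hBs ⟨1, by norm_num, rfl⟩⟩ : T 1) ∈ ((↑) ⁻¹' T (1/2) : Set (T 1)) := by
      rw [h]; trivial
    have := (T_sub this).1.2
    simp only [g] at this
    norm_num at this
  · intro h
    have h0 : ((0 : ℝ), (0 : ℝ)) ∈ T 1 := bar_sub one_pos (by constructor <;> norm_num)
    have : (⟨_, h0⟩ : T 1) ∈ ((↑) ⁻¹' (g '' Icc (1/2) 1) : Set (T 1)) := by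
      rw [h]; trivial
    obtain ⟨x, hx, hxe⟩ := this
    have := congrArg Prod.fst hxe
    simp only [g] at this
    linarith [hx.1]
  · rw [eq_univ_iff_forall]
    rintro ⟨p, hp⟩
    have hU : T 1 = T (1/2) ∪ g '' Icc (1/2) 1 := by
      rw [← hBc.isClosed.closure_eq, T, T, ← closure_union, ← image_union,
        Ioc_union_Icc_eq_Ioc (by norm_num) (by norm_num)]
    rw [hU] at hp
    exact hp

end SineCurve

/-- There exists a decomposable continuum `X`, not homeomorphic to the arc `[0,1]`,
such that `X² \ Δ` is not continuumwise connected in `X²`. -/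
theorem exists_decomposable_continuum_not_arc_with_compl_diagonal_not_cwConnected :
    ∃ (X : Type) (_ : MetricSpace X), CompactSpace X ∧ ConnectedSpace X ∧ Nontrivial X ∧
      (∃ A B : Set X, IsCompact A ∧ IsConnected A ∧ IsCompact B ∧ IsConnected B ∧
        A ≠ univ ∧ B ≠ univ ∧ A ∪ B = univ) ∧
      ¬ Nonempty (X ≃ₜ ↥(Set.Icc (0:ℝ) 1)) ∧
      ¬ ContinuumwiseConnected {w : X × X | w.1 ≠ w.2} := by
  refine ⟨SineCurve.T 1, inferInstance, isCompact_iff_compactSpace.1 (SineCurve.T_compact 1),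
    isConnected_iff_connectedSpace.1 (SineCurve.T_conn one_pos), ?_, SineCurve.decomp,
    SineCurve.not_arc, SineCurve.not_cw⟩
  refine ⟨⟨_, SineCurve.bar_sub one_pos (y := 0) (by constructor <;> norm_num)⟩,
    ⟨_, SineCurve.bar_sub one_pos (y := 1) (by constructor <;> norm_num)⟩, by simp⟩
end

section
/- Suppose there exists a homeomorphism f : C → C of the Cantor ternary set such that every orbit of f is dense in C, every orbit of f⁻¹ is dense in C, and f × f : C² → C² has a dense orbit. Then there exists an indecomposable continuum X such that X² \ Δ is continuumwise connected in X². -/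
open Set

noncomputable section

/-- The Cantor ternary set, as a topological (metric) space. -/
abbrev CantorT : Type := ↥cantorSet

/-- Embedding of the mapping torus. -/
def psiMap (F : ℤ → CantorT → CantorT) (p : CantorT × ℝ) : AddCircle (1:ℝ) × ℝ × ℝ :=
  ((p.2 : AddCircle (1:ℝ)), (1 - p.2) * (p.1 : ℝ) + p.2 * (F 1 p.1 : ℝ), p.2 * (1 - p.2) * (p.1 : ℝ))

/-- The covering map. -/
def piMap (F : ℤ → CantorT → CantorT) (p : CantorT × ℝ) : AddCircle (1:ℝ) × ℝ × ℝ :=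
  psiMap F (F ⌊p.2⌋ p.1, Int.fract p.2)

lemma continuous_psiMap (F : ℤ → CantorT → CantorT) (Fc : ∀ n, Continuous (F n)) :
    Continuous (psiMap F) := by
  have h1 := Fc 1
  have h2 : Continuous (fun x : ℝ => (x : AddCircle (1:ℝ))) := AddCircle.continuous_mk' 1
  unfold psiMap
  refine Continuous.prodMk (h2.comp continuous_snd) ?_
  fun_prop

lemma psiMap_one (F : ℤ → CantorT → CantorT) (x : CantorT) :
    psiMap F (x, 1) = psiMap F (F 1 x, 0) := by
  have : ((1:ℝ) : AddCircle (1:ℝ)) = 0 := AddCircle.coe_period 1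
  simp [psiMap, this]

lemma continuous_piMap (F : ℤ → CantorT → CantorT) (Fadd : ∀ m n x, F (m + n) x = F m (F n x))
    (Fc : ∀ n, Continuous (F n)) : Continuous (piMap F) := by
  have hlf : LocallyFinite (fun n : ℤ => (Prod.snd ⁻¹' Icc (n:ℝ) (n+1) : Set (CantorT × ℝ))) := by
    have : LocallyFinite (fun n : ℤ => Icc (n:ℝ) (n+1)) := by
      intro x
      refine ⟨Ioo (x-1) (x+1), Ioo_mem_nhds (by linarith) (by linarith), ?_⟩
      refine (Set.finite_Icc (⌊x⌋ - 3) (⌊x⌋ + 3)).subset ?_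
      rintro n ⟨y, ⟨h1, h2⟩, h3, h4⟩
      have h5 := Int.floor_le x
      have h6 := Int.lt_floor_add_one x
      constructor
      · have : ((⌊x⌋ - 3 : ℤ) : ℝ) ≤ n := by push_cast; linarith
        exact_mod_cast this
      · have : (n : ℝ) ≤ ((⌊x⌋ + 3 : ℤ) : ℝ) := by push_cast; linarith
        exact_mod_cast this
    exact this.preimage_continuous continuous_snd
  refine hlf.continuous ?_ (fun n => isClosed_Icc.preimage continuous_snd) ?_
  · rw [eq_univ_iff_forall]
    intro p
    exact mem_iUnion.2 ⟨⌊p.2⌋, Int.floor_le _, (Int.lt_floor_add_one _).le⟩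
  · intro n
    have hc : Continuous (fun p : CantorT × ℝ => psiMap F (F n p.1, p.2 - n)) := by
      have := Fc n
      exact (continuous_psiMap F Fc).comp (by fun_prop)
    refine hc.continuousOn.congr ?_
    rintro ⟨x, s⟩ ⟨h1, h2⟩
    simp only at h1 h2
    rcases eq_or_lt_of_le h2 with h | h
    · have hs : s = ((n+1 : ℤ) : ℝ) := by push_cast; exact h
      subst hs
      simp only [piMap, Int.floor_intCast, Int.fract_intCast]
      rw [add_comm n 1, Fadd, ← psiMap_one]
      congr 2
      push_cast; ring
    · have hf : ⌊s⌋ = n := Int.floor_eq_iff.2 ⟨h1, h⟩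
      simp only [piMap, Int.fract, hf]

lemma piMap_eq_iff (F : ℤ → CantorT → CantorT) (F0 : ∀ x, F 0 x = x)
    (Fadd : ∀ m n x, F (m + n) x = F m (F n x)) (x y : CantorT) (s t : ℝ) :
    piMap F (x, s) = piMap F (y, t) ↔ ∃ k : ℤ, t = s - k ∧ y = F k x := by
  constructor
  · intro h
    simp only [piMap, psiMap, Prod.mk.injEq] at h
    obtain ⟨h1, h2, h3⟩ := h
    have hfr : Int.fract s = Int.fract t := by
      rw [AddCircle.coe_eq_coe_iff_of_mem_Ico (p := (1:ℝ)) (a := 0)] at h1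
      · exact h1
      · exact ⟨Int.fract_nonneg _, by simpa using Int.fract_lt_one _⟩
      · exact ⟨Int.fract_nonneg _, by simpa using Int.fract_lt_one _⟩
    rw [← hfr] at h2 h3
    have hx : F ⌊s⌋ x = F ⌊t⌋ y := by
      by_cases h0 : Int.fract s = 0
      · rw [h0] at h2
        simpa [Subtype.ext_iff] using h2
      · have a1 : 1 - Int.fract s ≠ 0 := by
          have := Int.fract_lt_one s
          linarith
        have := mul_left_cancel₀ (mul_ne_zero h0 a1) h3
        exact Subtype.ext this
    refine ⟨⌊s⌋ - ⌊t⌋, ?_, ?_⟩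
    · have e1 := Int.floor_add_fract s
      have e2 := Int.floor_add_fract t
      push_cast; linarith
    · calc y = F (-⌊t⌋ + ⌊t⌋) y := by rw [neg_add_cancel, F0]
        _ = F (-⌊t⌋) (F ⌊s⌋ x) := by rw [Fadd, hx]
        _ = _ := by rw [← Fadd]; congr 1; ring
  · rintro ⟨k, rfl, rfl⟩
    simp only [piMap, Int.floor_sub_intCast, Int.fract_sub_intCast]
    rw [← Fadd, sub_add_cancel]

lemma exists_model (F : ℤ → CantorT → CantorT) (F0 : ∀ x, F 0 x = x)
    (Fadd : ∀ m n x, F (m + n) x = F m (F n x)) (Fc : ∀ n, Continuous (F n)) :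
    ∃ (X : Type) (_ : MetricSpace X) (π : CantorT × ℝ → X), Continuous π ∧
      Function.Surjective π ∧
      ∀ x y s t, π (x, s) = π (y, t) ↔ ∃ k : ℤ, t = s - k ∧ y = F k x := by
  refine ⟨range (piMap F), inferInstance, rangeFactorization (piMap F),
    (continuous_piMap F Fadd Fc).subtype_mk _, rangeFactorization_surjective, ?_⟩
  intro x y s t
  rw [← piMap_eq_iff F F0 Fadd]
  exact Subtype.ext_iff

section model
variable {X : Type} [MetricSpace X] {π : CantorT × ℝ → X} {F : ℤ → CantorT → CantorT}

instance : CompactSpace CantorT := isCompact_iff_compactSpace.1 isCompact_cantorSet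

instance : TotallyDisconnectedSpace CantorT :=
  cantorSetHomeomorphNatToBool.symm.totallyDisconnectedSpace

set_option linter.unusedSectionVars false in
lemma model_rep (hs : Function.Surjective π) 
    (hπ : ∀ x y s t, π (x, s) = π (y, t) ↔ ∃ k : ℤ, t = s - k ∧ y = F k x) (z : X) :
    ∃ x u, 0 ≤ u ∧ u < 1 ∧ π (x, u) = z := by
  obtain ⟨⟨x, s⟩, rfl⟩ := hs z
  exact ⟨F ⌊s⌋ x, Int.fract s, Int.fract_nonneg _, Int.fract_lt_one _,
    ((hπ _ _ _ _).2 ⟨⌊s⌋, rfl, rfl⟩).symm⟩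

lemma model_compact (hc : Continuous π) (hs : Function.Surjective π)
    (hπ : ∀ x y s t, π (x, s) = π (y, t) ↔ ∃ k : ℤ, t = s - k ∧ y = F k x) : CompactSpace X := by
  have h1 : IsCompact (π '' (univ ×ˢ Icc (0:ℝ) 1)) :=
    (isCompact_univ.prod isCompact_Icc).image hc
  refine ⟨?_⟩
  convert h1
  symm
  rw [eq_univ_iff_forall]
  intro z
  obtain ⟨x, u, h0, h1, rfl⟩ := model_rep hs hπ z
  exact ⟨(x, u), ⟨mem_univ _, h0, h1.le⟩, rfl⟩

lemma model_open (hc : Continuous π) (hs : Function.Surjective π)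
    (F0 : ∀ x, F 0 x = x) (Fadd : ∀ m n x, F (m + n) x = F m (F n x)) (Fc : ∀ n, Continuous (F n))
    (hπ : ∀ x y s t, π (x, s) = π (y, t) ↔ ∃ k : ℤ, t = s - k ∧ y = F k x) : IsOpenMap π := by
  have hcl : IsClosedMap (fun p : CantorT × Icc (0:ℝ) 1 => π (p.1, p.2)) :=
    Continuous.isClosedMap (by fun_prop)
  have hq : Topology.IsQuotientMap (fun p : CantorT × Icc (0:ℝ) 1 => π (p.1, p.2)) := by
    refine hcl.isQuotientMap (by fun_prop) ?_
    intro z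
    obtain ⟨x, u, h0, h1, rfl⟩ := model_rep hs hπ z
    exact ⟨(x, ⟨u, h0, h1.le⟩), rfl⟩
  have hq2 : Topology.IsQuotientMap π :=
    Topology.IsQuotientMap.of_comp (f := fun p : CantorT × Icc (0:ℝ) 1 => (p.1, (p.2:ℝ)))
      (by fun_prop) hc hq
  intro O hO
  rw [← hq2.isOpen_preimage]
  have : π ⁻¹' (π '' O) = ⋃ k : ℤ, (fun p : CantorT × ℝ => (F k p.1, p.2 - k)) ⁻¹' O := by
    ext ⟨x, s⟩
    simp only [mem_preimage, mem_image, Prod.exists, mem_iUnion]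
    constructor
    · rintro ⟨y, t, h, e⟩
      obtain ⟨k, rfl, rfl⟩ := (hπ _ _ _ _).1 e.symm
      exact ⟨k, h⟩
    · rintro ⟨k, h⟩
      exact ⟨_, _, h, ((hπ _ _ _ _).2 ⟨k, rfl, rfl⟩).symm⟩
  rw [this]
  refine isOpen_iUnion fun k => hO.preimage ?_
  have := Fc k
  fun_prop

/-- A closed connected proper subset has empty interior. -/
lemma model_indec (hc : Continuous π) (hs : Function.Surjective π)
    (F0 : ∀ x, F 0 x = x) (Fadd : ∀ m n x, F (m + n) x = F m (F n x)) (Fc : ∀ n, Continuous (F n))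
    (hπ : ∀ x y s t, π (x, s) = π (y, t) ↔ ∃ k : ℤ, t = s - k ∧ y = F k x)
    (hfwd : ∀ x, Dense (range fun n : ℕ => F n x)) (hbwd : ∀ x, Dense (range fun n : ℕ => F (-n) x))
    (hinf : ∀ V : Set CantorT, IsOpen V → V.Nonempty → V.Infinite)
    (K : Set X) (hK : IsClosed K) (hKc : IsPreconnected K) (hne : K ≠ univ) (U : Set X)
    (hU : IsOpen U) (hUn : U.Nonempty) (hUK : U ⊆ K) : False := by
  obtain ⟨z, hz⟩ := hUn
  obtain ⟨⟨x0, s0⟩, rfl⟩ := hs z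
  obtain ⟨w, hw⟩ := (ne_univ_iff_exists_notMem _).1 hne
  obtain ⟨⟨w0, j0⟩, rfl⟩ := hs w
  set V : Set CantorT := (fun x => π (x, s0)) ⁻¹' U
  set W : Set CantorT := (fun x => π (x, j0)) ⁻¹' Kᶜ
  have hV : IsOpen V := hU.preimage (by fun_prop)
  have hW : IsOpen W := hK.isOpen_compl.preimage (by fun_prop)
  -- forward hit
  obtain ⟨n, hn, hnW⟩ : ∃ n : ℤ, s0 < j0 + n ∧ F n x0 ∈ W := by
    obtain ⟨N, hN⟩ := exists_nat_gt (s0 - j0)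
    obtain ⟨_, ⟨i, rfl⟩, hy⟩ := (hfwd (F N x0)).exists_mem_open hW ⟨w0, hw⟩
    refine ⟨i + N, ?_, ?_⟩
    · push_cast
      have : (0:ℝ) ≤ i := Nat.cast_nonneg i
      linarith
    · rw [Fadd]; exact hy
  obtain ⟨m, hm, hmW⟩ : ∃ m : ℤ, j0 + m < s0 ∧ F m x0 ∈ W := by
    obtain ⟨N, hN⟩ := exists_nat_gt (j0 - s0)
    obtain ⟨_, ⟨i, rfl⟩, hy⟩ := (hbwd (F (-N) x0)).exists_mem_open hW ⟨w0, hw⟩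
    refine ⟨-i + -N, ?_, ?_⟩
    · push_cast
      have : (0:ℝ) ≤ i := Nat.cast_nonneg i
      linarith
    · rw [Fadd]; exact hy
  -- finite set of relevant shifts
  set I : Set ℤ := Icc ⌊s0 - (j0 + n)⌋ ⌈s0 - (j0 + m)⌉
  have hI : I.Finite := Set.finite_Icc _ _
  obtain ⟨y, hyV, hy⟩ : ∃ y ∈ V, y ∉ (fun k => F (-k) x0) '' I := by
    by_contra hcon
    push Not at hcon
    exact hinf V hV ⟨x0, hz⟩ ((hI.image _).subset hcon)
  have hOp : IsOpen (V ∩ F n ⁻¹' W ∩ F m ⁻¹' W ∩ ((fun k => F k y) '' I)ᶜ) :=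
    ((hV.inter (hW.preimage (Fc n))).inter (hW.preimage (Fc m))).inter
      (hI.image _).isClosed.isOpen_compl
  have hx0 : x0 ∈ V ∩ F n ⁻¹' W ∩ F m ⁻¹' W ∩ ((fun k => F k y) '' I)ᶜ := by
    refine ⟨⟨⟨hz, hnW⟩, hmW⟩, ?_⟩
    rintro ⟨k, hk, rfl⟩
    refine hy ⟨k, hk, ?_⟩
    simp only
    rw [← Fadd, neg_add_cancel, F0]
  obtain ⟨V', hV', hx0', hsub⟩ := compact_exists_isClopen_in_isOpen hOp hx0
  have o1 : IsOpen (π '' (V' ×ˢ Ioo (j0 + m) (j0 + n))) :=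
    model_open hc hs F0 Fadd Fc hπ _ (hV'.isOpen.prod isOpen_Ioo)
  have c1 : IsClosed (π '' (V' ×ˢ Icc (j0 + m) (j0 + n))) :=
    ((hV'.isClosed.isCompact.prod isCompact_Icc).image hc).isClosed
  have key : K ∩ π '' (V' ×ˢ Icc (j0 + m) (j0 + n)) ⊆ π '' (V' ×ˢ Ioo (j0 + m) (j0 + n)) := by
    rintro _ ⟨hKz, ⟨x, t⟩, ⟨hx, h1, h2⟩, rfl⟩
    simp only at hx h1 h2
    obtain ⟨⟨⟨-, hxn⟩, hxm⟩, -⟩ := hsub hx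
    refine ⟨(x, t), ⟨hx, lt_of_le_of_ne h1 ?_, lt_of_le_of_ne h2 ?_⟩, rfl⟩
    · rintro rfl
      apply hxm
      beta_reduce
      rwa [← (hπ x (F m x) (j0 + m) j0).2 ⟨m, by ring, rfl⟩]
    · rintro rfl
      apply hxn
      beta_reduce
      rwa [← (hπ x (F n x) (j0 + n) j0).2 ⟨n, by ring, rfl⟩]
  have hcov : K ⊆ π '' (V' ×ˢ Ioo (j0 + m) (j0 + n)) ∪ (π '' (V' ×ˢ Icc (j0 + m) (j0 + n)))ᶜ := by
    intro z hz
    by_cases h : z ∈ π '' (V' ×ˢ Icc (j0 + m) (j0 + n))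
    · exact Or.inl (key ⟨hz, h⟩)
    · exact Or.inr h
  have hyn : π (y, s0) ∉ π '' (V' ×ˢ Ioo (j0 + m) (j0 + n)) := by
    rintro ⟨⟨x, t⟩, ⟨hx, h1, h2⟩, e⟩
    simp only at hx h1 h2
    obtain ⟨k, rfl, rfl⟩ := (hπ _ _ _ _).1 e.symm
    refine (hsub hx).2 ⟨k, ⟨?_, ?_⟩, rfl⟩
    · have : ((⌊s0 - (j0 + n)⌋ : ℤ) : ℝ) ≤ k := by
        have := Int.floor_le (s0 - (j0 + n))
        linarith
      exact_mod_cast this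
    · have : (k : ℝ) ≤ (⌈s0 - (j0 + m)⌉ : ℤ) := by
        have := Int.le_ceil (s0 - (j0 + m))
        linarith
      exact_mod_cast this
  obtain ⟨z, -, hz1, hz2⟩ := hKc _ _ o1 c1.isOpen_compl hcov
    ⟨_, hUK hz, (x0, s0), ⟨hx0', hm, hn⟩, rfl⟩
    ⟨π (y, s0), hUK hyV, by
      rcases hcov (hUK hyV) with h | h
      · exact absurd h hyn
      · exact h⟩
  exact hz2 (image_mono (prod_mono le_rfl Ioo_subset_Icc_self) hz1)

/-- The set of good parameters. -/
def goodSet (F : ℤ → CantorT → CantorT) (a b : CantorT) (δ ε : ℝ) : Set (ℝ × ℝ) :=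
  {p | ∀ k : ℤ, |p.2 - k| < δ → ε ≤ dist (F ⌊p.1⌋ a) (F (⌊p.1⌋ + k) b)}

lemma goodSet_connected (a b : CantorT) (δ ε : ℝ) (hδ : δ ≤ 1/2)
    (hm : ∀ k : ℤ, ∃ m : ℤ, ε ≤ dist (F m a) (F (m + k) b)) :
    IsConnected (goodSet F a b δ ε) := by
  -- lines
  have hhalf : ∀ (k j : ℤ), 1/2 ≤ |(k:ℝ) + 1/2 - j| := by
    intro k j
    rcases le_or_gt j k with h | h
    · have : (j:ℝ) ≤ k := by exact_mod_cast h
      rw [abs_of_nonneg] <;> linarith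
    · have : (k:ℝ) + 1 ≤ j := by exact_mod_cast h
      rw [abs_of_nonpos] <;> linarith
  let L : ℤ → Set (ℝ × ℝ) := fun k => univ ×ˢ {(k:ℝ) + 1/2}
  have hLg : ∀ k, L k ⊆ goodSet F a b δ ε := by
    rintro k ⟨s, r⟩ ⟨-, hr⟩ j hj
    simp only [mem_singleton_iff] at hr
    subst hr
    have := hhalf k j
    simp only at hj
    linarith
  choose m hm using hm
  let V : ℤ → Set (ℝ × ℝ) := fun k => {(m k : ℝ)} ×ˢ Icc ((k:ℝ) - 1/2) (k + 1/2)
  have hVg : ∀ k, V k ⊆ goodSet F a b δ ε := by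
    rintro k ⟨s, r⟩ ⟨hs, h1, h2⟩ j hj
    simp only [mem_singleton_iff] at hs h1 h2 hj
    subst hs
    rw [abs_lt] at hj
    have : j = k := by
      have a1 : (j:ℝ) < k + 1 := by linarith
      have a2 : (k:ℝ) < j + 1 := by linarith
      norm_cast at a1 a2
      omega
    subst this
    simpa using hm j
  have hLc : ∀ k, IsConnected (L k) := fun k => isConnected_univ.prod isConnected_singleton
  have hVc : ∀ k, IsConnected (V k) := fun k =>
    isConnected_singleton.prod (isConnected_Icc (by linarith))
  have hLV : ∀ k, IsConnected (V k ∪ L k) := fun k =>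
    IsConnected.union ⟨((m k : ℝ), (k:ℝ) + 1/2), ⟨rfl, by constructor <;> simp only <;> linarith⟩, ⟨mem_univ _, rfl⟩⟩
      (hVc k) (hLc k)
  have hB : IsConnected (⋃ k, (V k ∪ L k)) := by
    refine IsConnected.iUnion_of_chain hLV ?_
    intro k
    refine ⟨((m (Order.succ k) : ℝ), (k:ℝ) + 1/2), Or.inr ⟨mem_univ _, rfl⟩, Or.inl ⟨rfl, ?_⟩⟩
    rw [Order.succ_eq_add_one]
    constructor <;> push_cast <;> linarith
  have hBg : (⋃ k, (V k ∪ L k)) ⊆ goodSet F a b δ ε :=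
    iUnion_subset fun k => union_subset (hVg k) (hLg k)
  -- each good point is joined to the lines
  obtain ⟨p0, hp0⟩ := hB.nonempty
  refine ⟨⟨p0, hBg hp0⟩, isPreconnected_of_forall p0 ?_⟩
  rintro ⟨s, r⟩ hg
  let k := ⌊r⌋
  have hk1 : (k:ℝ) ≤ r := Int.floor_le r
  have hk2 : r < k + 1 := Int.lt_floor_add_one r
  let J : Set (ℝ × ℝ) := {s} ×ˢ uIcc r (k + 1/2)
  have hJ : IsConnected J := isConnected_singleton.prod ⟨nonempty_uIcc, isPreconnected_uIcc⟩
  have hJg : J ⊆ goodSet F a b δ ε := by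
    rintro ⟨s', r'⟩ ⟨hs', hr'⟩ j hj
    simp only [mem_singleton_iff] at hs' hr' hj
    subst hs'
    refine hg j ?_
    simp only
    rw [abs_lt] at hj ⊢
    have hj2 : j = k ∨ j = k + 1 := by
      have b1 : (j:ℝ) < k + 2 := by
        rcases mem_uIcc.1 hr' with h | h <;> linarith
      have b2 : (k:ℝ) < j + 1 := by
        rcases mem_uIcc.1 hr' with h | h <;> linarith
      norm_cast at b1 b2
      omega
    rcases hj2 with rfl | rfl
    · rcases mem_uIcc.1 hr' with h | h
      · constructor <;> linarith
      · exfalso; linarith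
    · push_cast at hj ⊢
      rcases mem_uIcc.1 hr' with h | h
      · exfalso; linarith
      · constructor <;> linarith
  refine ⟨(⋃ k, (V k ∪ L k)) ∪ J, union_subset hBg hJg, Or.inl hp0, Or.inr ⟨rfl, left_mem_uIcc⟩, ?_⟩
  exact hB.isPreconnected.union (s, (k:ℝ) + 1/2) (mem_iUnion.2 ⟨k, Or.inr ⟨mem_univ _, rfl⟩⟩)
    ⟨rfl, right_mem_uIcc⟩ hJ.isPreconnected

lemma closure_good_subset (hc : Continuous π)
    (F0 : ∀ x, F 0 x = x) (Fadd : ∀ m n x, F (m + n) x = F m (F n x)) (Fc : ∀ n, Continuous (F n))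
    (hπ : ∀ x y s t, π (x, s) = π (y, t) ↔ ∃ k : ℤ, t = s - k ∧ y = F k x)
    (a b : CantorT) (δ ε : ℝ) (hδ : 0 < δ) (hε : 0 < ε) :
    closure ((fun p : ℝ × ℝ => (π (a, p.1), π (b, p.1 + p.2))) '' goodSet F a b δ ε) ⊆
      {w : X × X | w.1 ≠ w.2} := by
  let T : Set ((CantorT × ℝ) × (CantorT × ℝ)) := ((univ ×ˢ Icc (0:ℝ) 1) ×ˢ (univ ×ˢ Icc (0:ℝ) 1)) ∩
    ⋂ k : ℤ, ({p | δ ≤ |p.2.2 - p.1.2 + k|} ∪ {p | ε ≤ dist p.1.1 (F (-k) p.2.1)})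
  have hT : IsCompact T := by
    refine IsCompact.inter_right ((isCompact_univ.prod isCompact_Icc).prod
      (isCompact_univ.prod isCompact_Icc)) ?_
    refine isClosed_iInter fun k => IsClosed.union ?_ ?_
    · exact isClosed_le (by fun_prop) (by fun_prop)
    · have := Fc (-k)
      exact isClosed_le (by fun_prop) (by fun_prop)
  have hG : IsCompact (Prod.map π π '' T) := hT.image (hc.prodMap hc)
  refine (closure_minimal ?_ hG.isClosed).trans ?_
  · rintro _ ⟨⟨s, r⟩, hg, rfl⟩
    refine ⟨((F ⌊s⌋ a, Int.fract s), (F ⌊s + r⌋ b, Int.fract (s + r))), ⟨⟨⟨mem_univ _, Int.fract_nonneg _, (Int.fract_lt_one _).le⟩, ⟨mem_univ _, Int.fract_nonneg _, (Int.fract_lt_one _).le⟩⟩, ?_⟩, ?_⟩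
    · refine mem_iInter.2 fun k => ?_
      by_cases h : δ ≤ |Int.fract (s + r) - Int.fract s + k|
      · exact Or.inl h
      · right
        have := hg (⌊s + r⌋ - ⌊s⌋ - k) (by
          push Not at h
          have e : r - ((⌊s + r⌋ - ⌊s⌋ - k : ℤ) : ℝ) = Int.fract (s + r) - Int.fract s + k := by
            unfold Int.fract
            push_cast
            ring
          simp only
          rw [e]
          exact h)
        simp only [mem_ofPred_eq]
        rw [← Fadd]
        convert this using 3
        ring
    · simp only [Prod.map]
      exact Prod.ext ((hπ _ _ _ _).2 ⟨⌊s⌋, rfl, rfl⟩).symm ((hπ _ _ _ _).2 ⟨⌊s + r⌋, rfl, rfl⟩).symm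
  · rintro _ ⟨⟨⟨x, u⟩, ⟨y, v⟩⟩, ⟨-, h⟩, rfl⟩ e
    simp only [Prod.map] at e
    obtain ⟨k, rfl, rfl⟩ := (hπ _ _ _ _).1 e
    rcases mem_iInter.1 h k with h | h
    · simp only [mem_ofPred_eq] at h
      rw [show u - (k:ℝ) - u + k = 0 by ring, abs_zero] at h
      linarith
    · simp only [mem_ofPred_eq] at h
      rw [← Fadd, neg_add_cancel, F0, dist_self] at h
      linarith

lemma mem_closure_good (hc : Continuous π)
    (F0 : ∀ x, F 0 x = x) (Fadd : ∀ m n x, F (m + n) x = F m (F n x)) (hs : Function.Surjective π)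
    (hπ : ∀ x y s t, π (x, s) = π (y, t) ↔ ∃ k : ℤ, t = s - k ∧ y = F k x)
    (a b : CantorT) (hd : Dense (range fun n : ℕ => (F n a, F n b))) (w : X × X) (hw : w.1 ≠ w.2) :
    ∃ δ₀ > 0, ∃ ε₀ > 0, ∀ δ ≤ δ₀, ∀ ε ≤ ε₀,
    w ∈ closure ((fun p : ℝ × ℝ => (π (a, p.1), π (b, p.1 + p.2))) '' goodSet F a b δ ε) := by
  obtain ⟨w1, w2⟩ := w
  obtain ⟨c, u, hu0, hu1, rfl⟩ := model_rep hs hπ w1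
  obtain ⟨c', v, hv0, hv1, rfl⟩ := model_rep hs hπ w2
  simp only at hw
  -- reduction
  have main : ∀ δ ε : ℝ, δ ≤ 1 - |v - u| → (c = c' → δ ≤ |v - u|) → (c ≠ c' → ε < dist c c') →
      ((π (c, u), π (c', v)) : X × X) ∈
        closure ((fun p : ℝ × ℝ => (π (a, p.1), π (b, p.1 + p.2))) '' goodSet F a b δ ε) := by
    intro δ ε h1 h2 h3
    rw [mem_closure_iff]
    intro O hO hwO
    let G : Set (CantorT × CantorT) := (fun p => ((π (p.1, u), π (p.2, v)) : X × X)) ⁻¹' O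
    have hG : IsOpen G := hO.preimage (by fun_prop)
    let H : Set (CantorT × CantorT) := {p | c ≠ c' → ε < dist p.1 p.2}
    have hH : IsOpen H := by
      by_cases h : c = c'
      · simp [H, h]
      · simp only [H, ne_eq, h, not_false_eq_true, forall_const]
        exact isOpen_lt (by fun_prop) (by fun_prop)
    obtain ⟨_, ⟨n, rfl⟩, hn1, hn2⟩ := hd.exists_mem_open (hG.inter hH) ⟨(c, c'), hwO, h3⟩
    have e1 : π (a, (n:ℝ) + u) = π (F n a, u) := (hπ _ _ _ _).2 ⟨n, by push_cast; ring, rfl⟩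
    have e2 : π (b, (n:ℝ) + u + (v - u)) = π (F n b, v) :=
      (hπ _ _ _ _).2 ⟨n, by push_cast; ring, rfl⟩
    refine ⟨(π (F n a, u), π (F n b, v)), hn1, ((n:ℝ) + u, v - u), ?_, ?_⟩
    · intro k hk
      simp only at hk
      have hfl : ⌊(n:ℝ) + u⌋ = (n:ℤ) := Int.floor_eq_iff.2 ⟨by push_cast; linarith, by push_cast; linarith⟩
      simp only [hfl]
      have hk0 : k = 0 := by
        by_contra hk0
        have : (1:ℝ) ≤ |(k:ℝ)| := by
          have := Int.one_le_abs hk0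
          exact_mod_cast this
        have h4 := abs_sub_abs_le_abs_sub (k:ℝ) (v - u)
        rw [abs_sub_comm (k:ℝ)] at h4
        linarith
      subst hk0
      simp only [Int.cast_zero, sub_zero] at hk
      rw [add_zero]
      have hcc : c ≠ c' := fun h => by have := h2 h; linarith
      exact (hn2 hcc).le
    · simp only [e1, e2]
  have hvu : |v - u| < 1 := by rw [abs_lt]; constructor <;> linarith
  by_cases hcc : c = c'
  · have huv : 0 < |v - u| := by
      rw [abs_pos, sub_ne_zero]
      rintro rfl
      exact hw (by rw [hcc])
    refine ⟨min (1 - |v - u|) |v - u|, lt_min (by linarith) huv, 1, one_pos, fun δ hδ ε hε => ?_⟩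
    exact main δ ε (hδ.trans (min_le_left _ _)) (fun _ => hδ.trans (min_le_right _ _))
      (fun h => absurd hcc h)
  · have := dist_pos.2 hcc
    refine ⟨1 - |v - u|, by linarith, dist c c' / 2, by linarith, fun δ hδ ε hε => ?_⟩
    exact main δ ε hδ (fun h => absurd h hcc) (fun _ => by linarith)

end model

/-- If there is a homeomorphism `f` of the Cantor set all of whose orbits are dense, all of
whose inverse orbits are dense, and with `f × f` having a dense orbit, then there exists an
indecomposable continuum `X` (compact, connected, metric, nondegenerate, and not the union
of two proper subcontinua) such that `X² \ Δ` is continuumwise connected in `X²`. -/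
theorem exists_indecomposable_continuum_with_compl_diagonal_cwConnected
    (h : ∃ f : CantorT ≃ₜ CantorT,
      (∀ x : CantorT, Dense (Set.range fun n : ℕ => (⇑f)^[n] x)) ∧
      (∀ x : CantorT, Dense (Set.range fun n : ℕ => (⇑f.symm)^[n] x)) ∧
      (∃ z : CantorT × CantorT, Dense (Set.range fun n : ℕ => (Prod.map ⇑f ⇑f)^[n] z))) :
    ∃ (X : Type) (_ : MetricSpace X), CompactSpace X ∧ ConnectedSpace X ∧ Nontrivial X ∧
      (¬ ∃ A B : Set X, IsCompact A ∧ IsConnected A ∧ IsCompact B ∧ IsConnected B ∧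
        A ≠ univ ∧ B ≠ univ ∧ A ∪ B = univ) ∧
      ContinuumwiseConnected {w : X × X | w.1 ≠ w.2} := by
  obtain ⟨f, hf, hb, ⟨a, b⟩, hab⟩ := h
  let F : ℤ → CantorT → CantorT := fun n => ⇑(f ^ n)
  have F0 : ∀ x, F 0 x = x := fun x => by simp [F]
  have Fadd : ∀ m n x, F (m + n) x = F m (F n x) := fun m n x => by
    simp only [F, zpow_add]; rfl
  have Fc : ∀ n, Continuous (F n) := fun n => (f ^ n).continuous
  have F1 : ∀ x, F 1 x = f x := fun x => by simp [F]
  have Fm1 : ∀ x, F (-1) x = f.symm x := fun x => by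
    simp only [F, zpow_neg_one]; rfl
  have Fn : ∀ (n : ℕ) x, F n x = f^[n] x := by
    intro n
    induction n with
    | zero => intro x; simpa using F0 x
    | succ n ih => intro x; push_cast; rw [Fadd, ih, F1]; rfl
  have Fneg : ∀ (n : ℕ) x, F (-n) x = f.symm^[n] x := by
    intro n
    induction n with
    | zero => intro x; simpa using F0 x
    | succ n ih => intro x; push_cast; rw [neg_add, Fadd, ih, Fm1]; rfl
  have hfwd : ∀ x, Dense (range fun n : ℕ => F n x) := by simpa only [Fn] using hf
  have hbwd : ∀ x, Dense (range fun n : ℕ => F (-n) x) := by simpa only [Fneg] using hb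
  have hd : Dense (range fun n : ℕ => (F n a, F n b)) := by
    simp only [Fn]
    simpa only [Prod.map_iterate, Prod.map] using hab
  clear_value F
  -- two distinct points
  let p0 : CantorT := ⟨0, zero_mem_cantorSet⟩
  let p1 : CantorT := ⟨1/4, quarter_mem_cantorSet⟩
  have hp : dist p0 p1 = 1/4 := by
    rw [Subtype.dist_eq]
    simp [p0, p1, Real.dist_eq]
  have hinf : ∀ V : Set CantorT, IsOpen V → V.Nonempty → V.Infinite := by
    rintro V hV ⟨x, hx⟩ hfin
    have ho : IsOpen ({x} : Set CantorT) := by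
      have : ({x} : Set CantorT) = V ∩ (V \ {x})ᶜ := by
        ext y; simp only [mem_singleton_iff, mem_inter_iff, mem_compl_iff, mem_sdiff]
        constructor
        · rintro rfl; simp [hx]
        · rintro ⟨h1, h2⟩; by_contra h; exact h2 ⟨h1, h⟩
      rw [this]
      exact hV.inter (hfin.subset sdiff_subset).isClosed.isOpen_compl
    obtain ⟨_, ⟨n, rfl⟩, h1, h2⟩ := hd.exists_mem_open (ho.prod ho) ⟨(x, x), rfl, rfl⟩
    simp only [mem_singleton_iff] at h1 h2
    have hh : a = b := by
      rw [← F0 a, ← F0 b, ← neg_add_cancel (n:ℤ), Fadd, Fadd, h1, h2]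
    subst hh
    obtain ⟨_, ⟨n, rfl⟩, h1⟩ := hd.exists_mem_open
      (isOpen_lt (continuous_const (y := (0:ℝ))) (continuous_fst.dist continuous_snd))
      ⟨(p0, p1), by simp only [mem_ofPred_eq, hp]; norm_num⟩
    simp at h1
  obtain ⟨X, _, π, hc, hs, hπ⟩ := exists_model F F0 Fadd Fc
  have hcomp := model_compact hc hs hπ
  have hfar : ∀ ε ≤ (1/8 : ℝ), ∀ k : ℤ, ∃ m : ℤ, ε ≤ dist (F m a) (F (m + k) b) := by
    intro ε hε k
    have hk := Fc k
    obtain ⟨_, ⟨n, rfl⟩, h1⟩ := hd.exists_mem_open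
      (isOpen_lt (continuous_const (y := ε))
        (continuous_fst.dist ((Fc k).comp continuous_snd)))
      ⟨(p0, F (-k) p1), by
        simp only [mem_ofPred_eq, Function.comp]
        rw [← Fadd, add_neg_cancel, F0, hp]; linarith⟩
    refine ⟨n, ?_⟩
    rw [add_comm, Fadd]
    exact le_of_lt h1
  refine ⟨X, inferInstance, hcomp, ?_, ?_, ?_, ?_⟩
  · have h1 : IsConnected (range fun s : ℝ => π (a, s)) := isConnected_range (by fun_prop)
    have h2 : Dense (range fun s : ℝ => π (a, s)) := by
      intro z
      rw [mem_closure_iff]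
      intro O hO hz
      obtain ⟨⟨x, s⟩, rfl⟩ := hs z
      obtain ⟨_, ⟨n, rfl⟩, h1⟩ := (hfwd a).exists_mem_open
        (hO.preimage (f := fun x => π (x, s)) (by fun_prop)) ⟨x, hz⟩
      refine ⟨_, h1, s + n, ?_⟩
      exact (hπ _ _ _ _).2 ⟨n, by push_cast; ring, rfl⟩
    have h3 := h1.closure
    rw [h2.closure_eq] at h3
    exact connectedSpace_iff_univ.2 h3
  · refine ⟨π (p0, 0), π (p0, 1/2), fun e => ?_⟩
    obtain ⟨k, hk, -⟩ := (hπ _ _ _ _).1 e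
    have : (2 * k : ℤ) = (-1 : ℤ) := by
      have : (2 * k : ℝ) = -1 := by linarith
      exact_mod_cast this
    omega
  · rintro ⟨A, B, hA, hA', hB, hB', hAu, hBu, hAB⟩
    refine model_indec hc hs F0 Fadd Fc hπ hfwd hbwd hinf B hB.isClosed hB'.isPreconnected hBu
      Aᶜ hA.isClosed.isOpen_compl (nonempty_compl.2 hAu) ?_
    intro z hz
    have : z ∈ A ∪ B := hAB ▸ mem_univ z
    exact this.resolve_left hz
  · intro p hp q hq
    obtain ⟨δ₁, hδ₁, ε₁, hε₁, H1⟩ := mem_closure_good hc F0 Fadd hs hπ a b hd p hp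
    obtain ⟨δ₂, hδ₂, ε₂, hε₂, H2⟩ := mem_closure_good hc F0 Fadd hs hπ a b hd q hq
    let δ := min (1/2) (min δ₁ δ₂)
    let ε := min (1/8) (min ε₁ ε₂)
    have hδ : 0 < δ := lt_min (by norm_num) (lt_min hδ₁ hδ₂)
    have hε : 0 < ε := lt_min (by norm_num) (lt_min hε₁ hε₂)
    refine ⟨closure ((fun p : ℝ × ℝ => (π (a, p.1), π (b, p.1 + p.2))) '' goodSet F a b δ ε),
      isClosed_closure.isCompact, ?_, ?_, ?_,
      closure_good_subset hc F0 Fadd Fc hπ a b δ ε hδ hε⟩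
    · refine IsConnected.closure (IsConnected.image ?_ _ (by fun_prop))
      exact goodSet_connected a b δ ε (min_le_left _ _) (hfar ε (min_le_left _ _))
    · exact H1 δ ((min_le_right _ _).trans (min_le_left _ _)) ε ((min_le_right _ _).trans (min_le_left _ _))
    · exact H2 δ ((min_le_right _ _).trans (min_le_right _ _)) ε ((min_le_right _ _).trans (min_le_right _ _))
end
end
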